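/- For all integers e, m with 3 ≤ e < m and m − e ≤ 6: every numerical monoid Γ with embedding dimension e+1 and multiplicity m satisfies ρ(Γ) ≤ 𝒞(e,m), and there exists a numerical monoid Γ with embedding dimension e+1, multiplicity m, and ρ(Γ) = 𝒞(e,m). -/

import Mathlib

open scoped Pointwise

/-- A numerical monoid: an additive submonoid of ℕ with finite complement. -/
def IsNumericalMonoid (Γ : AddSubmonoid ℕ) : Prop :=
  ((Γ : Set ℕ)ᶜ).Finite

/-- The (unique) minimal generating set of a submonoid of ℕ: the nonzero elements
that are not sums of two nonzero elements. -/
def minGens (Γ : AddSubmonoid ℕ) : Set ℕ :=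
  {g | g ∈ Γ ∧ g ≠ 0 ∧ ∀ a ∈ Γ, ∀ b ∈ Γ, a ≠ 0 → b ≠ 0 → g ≠ a + b}

/-- Embedding dimension: the number of minimal generators. -/
noncomputable def edim (Γ : AddSubmonoid ℕ) : ℕ :=
  (minGens Γ).ncard

/-- Multiplicity: the smallest nonzero element. -/
noncomputable def mult (Γ : AddSubmonoid ℕ) : ℕ :=
  sInf {g : ℕ | g ∈ Γ ∧ g ≠ 0}

/-- The factorization homomorphism φ, sending a formal ℕ-combination of the minimal
generators to its value in ℕ. -/
noncomputable def factorizationHom (Γ : AddSubmonoid ℕ) : (minGens Γ →₀ ℕ) →+ ℕ :=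
  Finsupp.liftAddHom fun g => AddMonoidHom.mulLeft (g : ℕ)

/-- The number of minimal relations ρ(Γ): the least cardinality of a set of pairs
generating the kernel congruence of the factorization homomorphism. -/
noncomputable def rho (Γ : AddSubmonoid ℕ) : ℕ :=
  sInf {n : ℕ | ∃ R : Set ((minGens Γ →₀ ℕ) × (minGens Γ →₀ ℕ)),
    R.Finite ∧ R.ncard = n ∧
    addConGen (fun a b => (a, b) ∈ R) = AddCon.ker (factorizationHom Γ)}

/-- Pseudo-Frobenius numbers of Γ. -/
def pseudoFrobenius (Γ : AddSubmonoid ℕ) : Set ℕ :=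
  {p | p ∉ Γ ∧ ∀ g ∈ Γ, g ≠ 0 → p + g ∈ Γ}

/-- The type of Γ: the number of pseudo-Frobenius numbers. -/
noncomputable def numType (Γ : AddSubmonoid ℕ) : ℕ :=
  (pseudoFrobenius Γ).ncard

/-- The Apéry set of Γ with respect to its multiplicity. -/
def aperySet (Γ : AddSubmonoid ℕ) : Set ℕ :=
  {g | g ∈ Γ ∧ ¬ ∃ γ ∈ Γ, g = γ + mult Γ}

/-- The Macaulay upper function: if `n = C(n_d,d) + ⋯ + C(n_j,j)` is the Macaulay
expansion of `n`, then `macUpper d n = C(n_d+1,d+1) + ⋯ + C(n_j+1,j+1)`, i.e. `n^⟨d⟩`. -/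
noncomputable def macUpper : ℕ → ℕ → ℕ
  | 0, _ => 0
  | d + 1, n =>
    if n = 0 then 0
    else
      Nat.choose (sSup {a : ℕ | Nat.choose a (d + 1) ≤ n} + 1) (d + 2) +
        macUpper d (n - Nat.choose (sSup {a : ℕ | Nat.choose a (d + 1) ≤ n}) (d + 1))

/-- The Macaulay lower function: if `n = C(n_d,d) + ⋯ + C(n_j,j)` is the Macaulay
expansion of `n`, then `macLower d n = C(n_d-1,d) + ⋯ + C(n_j-1,j)`, i.e. `n_⟨d⟩`. -/
noncomputable def macLower : ℕ → ℕ → ℕ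
  | 0, _ => 0
  | d + 1, n =>
    if n = 0 then 0
    else
      Nat.choose (sSup {a : ℕ | Nat.choose a (d + 1) ≤ n} - 1) (d + 1) +
        macLower d (n - Nat.choose (sSup {a : ℕ | Nat.choose a (d + 1) ≤ n}) (d + 1))

/-- The unique positive `r` with `C(e+r-1,r-1) ≤ m < C(e+r,r)`. -/
noncomputable def macR (e m : ℕ) : ℕ :=
  sInf {r : ℕ | 0 < r ∧ m < Nat.choose (e + r) r}

/-- The bound 𝒞(e,m) = C(e+r-1,r) + s^⟨r⟩ - s, where s = m - C(e+r-1,r-1). -/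
noncomputable def mathcalC (e m : ℕ) : ℕ :=
  Nat.choose (e + macR e m - 1) (macR e m) +
      macUpper (macR e m) (m - Nat.choose (e + macR e m - 1) (macR e m - 1)) -
    (m - Nat.choose (e + macR e m - 1) (macR e m - 1))

/-- The bound 𝒟(e,m) = C(e+r-2,r-1) + s_⟨r⟩, where s = m - C(e+r-1,r-1). -/
noncomputable def mathcalD (e m : ℕ) : ℕ :=
  Nat.choose (e + macR e m - 2) (macR e m - 1) +
    macLower (macR e m) (m - Nat.choose (e + macR e m - 1) (macR e m - 1))

/-- The values `s^⟨2⟩` of the Macaulay upper function in degree two, for `s ≤ 5`. -/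
def quadraticGrowth : ℕ → ℕ
  | 0 => 0
  | 1 => 1
  | 2 => 2
  | 3 => 4
  | 4 => 5
  | _ => 7

theorem quadraticGrowth_step {c d t : ℕ} (hc : 1 ≤ c) (h : d + c ≤ 5)
    (ht : t ≤ d + c) (ht' : t ≤ (c + 1).choose 2) :
    quadraticGrowth d + t ≤ quadraticGrowth (d + c) := by
  have hc5 : c ≤ 5 := by omega
  have hd5 : d ≤ 5 := by omega
  interval_cases c <;> interval_cases d <;>
    simp [quadraticGrowth, Nat.choose] at * <;> omega

theorem quadraticGrowth_sub_le {a b : ℕ} (hab : a ≤ b) (hb : b ≤ 5) :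
    quadraticGrowth a + b ≤ quadraticGrowth b + a := by
  interval_cases b <;> interval_cases a <;> simp [quadraticGrowth]

namespace Finsupp

variable {α : Type*}

theorem exists_single_add_of_apply_ne_zero {u : α →₀ ℕ} {x : α} (hx : u x ≠ 0) :
    ∃ v, u = single x 1 + v :=
  ⟨u - single x 1, (add_tsub_cancel_of_le (by
    simpa [Finsupp.single_le_iff] using Nat.one_le_iff_ne_zero.mpr hx)).symm⟩

theorem exists_single_add_of_ne_zero {u : α →₀ ℕ} (hu : u ≠ 0) :
    ∃ x v, u = single x 1 + v := by
  obtain ⟨x, hx⟩ := Finsupp.ne_iff.mp hu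
  exact ⟨x, exists_single_add_of_apply_ne_zero hx⟩

theorem lt_single_add (x : α) (v : α →₀ ℕ) : v < single x 1 + v := by
  refine lt_of_le_of_ne le_add_self fun h => ?_
  have := DFunLike.congr_fun h x
  simp at this

/-- The monomial of degree two given by an unordered pair of variables. -/
noncomputable def ofSym2 (p : Sym2 α) : α →₀ ℕ :=
  Sym2.lift ⟨fun x y => single x 1 + single y 1, fun _ _ => add_comm _ _⟩ p

@[simp]
theorem ofSym2_mk (x y : α) : ofSym2 s(x, y) = single x 1 + single y 1 := rfl

theorem ofSym2_injective : Function.Injective (ofSym2 : Sym2 α → α →₀ ℕ) := by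
  classical
  intro p q
  induction p using Sym2.ind with | _ a b
  induction q using Sym2.ind with | _ c d
  intro h
  simp only [ofSym2_mk] at h
  have h' := congrArg Finsupp.toMultiset h
  simp only [map_add, toMultiset_single, one_smul] at h'
  rw [Multiset.singleton_add, Multiset.singleton_add] at h'
  rw [Sym2.eq_iff]
  rcases Multiset.cons_eq_cons.mp h' with ⟨rfl, h2⟩ | ⟨hne, cs, h2, h3⟩
  · left; simpa using h2
  · right
    rw [Multiset.singleton_eq_cons_iff] at h2 h3
    exact ⟨h3.1.symm, h2.1⟩

theorem exists_ofSym2_of_degree_eq_two {u : α →₀ ℕ} (h : u.degree = 2) :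
    ∃ p, ofSym2 p = u := by
  have hu : u ≠ 0 := by rintro rfl; simp at h
  obtain ⟨x, v, rfl⟩ := exists_single_add_of_ne_zero hu
  have hv1 : v.degree = 1 := by rw [map_add, degree_single] at h; omega
  have hv : v ≠ 0 := by rintro rfl; simp at hv1
  obtain ⟨y, w, rfl⟩ := exists_single_add_of_ne_zero hv
  have hw : w.degree = 0 := by rw [map_add, degree_single] at hv1; omega
  rw [degree_eq_zero_iff] at hw
  exact ⟨s(x, y), by simp [hw]⟩

/-- A form of Macaulay's bound in degrees at least two, for at most five monomials. -/
theorem card_le_quadraticGrowth (D T : Finset (α →₀ ℕ)) (hcard : D.card ≤ 5)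
    (hD : ∀ u ∈ D, 2 ≤ u.degree)
    (hcl : ∀ u ∈ D, ∀ v ≤ u, 2 ≤ v.degree → v ∈ D)
    (hT : ∀ u ∈ T, 3 ≤ u.degree ∧ ∀ v < u, 2 ≤ v.degree → v ∈ D) :
    T.card ≤ quadraticGrowth D.card := by
  classical
  induction hn : D.card using Nat.strong_induction_on generalizing D T with
  | _ n ih =>
  subst hn
  rcases D.eq_empty_or_nonempty with rfl | ⟨u₀, hu₀⟩
  · suffices T = ∅ by simp [this, quadraticGrowth]
    refine Finset.eq_empty_of_forall_notMem fun u hu => ?_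
    obtain ⟨h3, h⟩ := hT u hu
    have hu0 : u ≠ 0 := by rintro rfl; simp at h3
    obtain ⟨x, v, rfl⟩ := exists_single_add_of_ne_zero hu0
    have := h v (lt_single_add x v) (by rw [map_add, degree_single] at h3; omega)
    simp at this
  · have hu0 : u₀ ≠ 0 := by rintro rfl; simpa using hD _ hu₀
    obtain ⟨x, v₀, rfl⟩ := exists_single_add_of_ne_zero hu0
    set D₀ := D.filter (fun u => u x = 0) with hD₀
    set D₁ := D.filter (fun u => ¬ u x = 0) with hD₁
    set T₀ := T.filter (fun u => u x = 0) with hT₀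
    set T₁ := T.filter (fun u => ¬ u x = 0) with hT₁
    have hDc : D₀.card + D₁.card = D.card := Finset.card_filter_add_card_filter_not _
    have hTc : T₀.card + T₁.card = T.card := Finset.card_filter_add_card_filter_not _
    have hpos : 1 ≤ D₁.card :=
      Finset.card_pos.mpr ⟨single x 1 + v₀, by simp [hD₁, hu₀]⟩
    have h0 : T₀.card ≤ quadraticGrowth D₀.card := by
      refine ih _ (by omega) D₀ T₀ (by omega) ?_ ?_ ?_ rfl
      · exact fun u hu => hD u (Finset.mem_filter.mp hu).1
      · intro u hu v hv h2
        rw [hD₀, Finset.mem_filter] at hu ⊢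
        exact ⟨hcl u hu.1 v hv h2, Nat.le_zero.mp (hu.2 ▸ hv x)⟩
      · intro u hu
        rw [hT₀, Finset.mem_filter] at hu
        refine ⟨(hT u hu.1).1, fun v hv h2 => ?_⟩
        rw [hD₀, Finset.mem_filter]
        exact ⟨(hT u hu.1).2 v hv h2, Nat.le_zero.mp (hu.2 ▸ hv.le x)⟩
    set E := D₁.image (fun u => u - single x 1) with hE
    have hEcard : E.card ≤ D₁.card := Finset.card_image_le
    have hmemE : ∀ w, single x 1 + w ∈ D → w ∈ E := by
      intro w hw
      refine Finset.mem_image.mpr ⟨single x 1 + w, ?_, by simp⟩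
      simp [hD₁, hw]
    have hT₁' : ∀ u ∈ T₁, ∃ v, u = single x 1 + v ∧ u ∈ T := by
      intro u hu
      rw [hT₁, Finset.mem_filter] at hu
      obtain ⟨v, hv⟩ := exists_single_add_of_apply_ne_zero hu.2
      exact ⟨v, hv, hu.1⟩
    have hinj : Set.InjOn (fun u : α →₀ ℕ => u - single x 1) T₁ := by
      intro u hu w hw h
      obtain ⟨v, rfl, -⟩ := hT₁' u hu
      obtain ⟨v', rfl, -⟩ := hT₁' w hw
      simpa using h
    have h1 : T₁.card ≤ D.card := by
      refine Finset.card_le_card_of_injOn (fun u => u - single x 1) ?_ hinj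
      intro u hu
      obtain ⟨v, rfl, huT⟩ := hT₁' u hu
      have h3 := (hT _ huT).1
      simpa using (hT _ huT).2 v (lt_single_add x v)
        (by rw [map_add, degree_single] at h3; omega)
    have h2 : T₁.card ≤ (D₁.card + 1).choose 2 := by
      calc T₁.card ≤ (E.sym2.image fun p => Sym2.lift ⟨fun a b => a + b, add_comm⟩ p).card := by
            refine Finset.card_le_card_of_injOn (fun u => u - single x 1) ?_ hinj
            intro u hu
            obtain ⟨v, rfl, huT⟩ := hT₁' u hu
            obtain ⟨h3, hlt⟩ := hT _ huT
            rw [map_add, degree_single] at h3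
            have hv0 : v ≠ 0 := by rintro rfl; simp at h3
            obtain ⟨y, w, rfl⟩ := exists_single_add_of_ne_zero hv0
            rw [map_add, degree_single] at h3
            have hw0 : 0 < w := by
              refine pos_iff_ne_zero.mpr ?_
              rintro rfl; simp at h3
            have hy : single y 1 ∈ E := by
              refine hmemE _ (hlt _ ?_ (by simp))
              rw [← add_assoc]
              exact lt_add_of_pos_right _ hw0
            have hwE : w ∈ E := by
              refine hmemE _ (hlt _ ?_ (by rw [map_add, degree_single]; omega))
              rw [add_left_comm]
              exact lt_single_add _ _
            simp only [add_tsub_cancel_left, Finset.coe_image, Set.mem_image, Finset.mem_coe]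
            exact ⟨s(single y 1, w), Finset.mk_mem_sym2_iff.mpr ⟨hy, hwE⟩, rfl⟩
        _ ≤ E.sym2.card := Finset.card_image_le
        _ = (E.card + 1).choose 2 := Finset.card_sym2 _
        _ ≤ (D₁.card + 1).choose 2 := Nat.choose_le_choose _ (by omega)
    have := quadraticGrowth_step (c := D₁.card) (d := D₀.card) (t := T₁.card)
      hpos (by omega) (by omega) h2
    rw [hDc] at this
    omega

end Finsupp

theorem factorizationHom_single (Γ : AddSubmonoid ℕ) (g : minGens Γ) (n : ℕ) :
    factorizationHom Γ (Finsupp.single g n) = g * n := by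
  simp [factorizationHom]

theorem factorizationHom_mem (Γ : AddSubmonoid ℕ) (u : minGens Γ →₀ ℕ) :
    factorizationHom Γ u ∈ Γ := by
  induction u using Finsupp.induction_linear with
  | zero => simp
  | add f g hf hg => rw [map_add]; exact add_mem hf hg
  | single a b =>
    rw [factorizationHom_single, mul_comm, ← smul_eq_mul]
    exact nsmul_mem a.2.1 b

theorem mul_le_factorizationHom {Γ : AddSubmonoid ℕ} (u : minGens Γ →₀ ℕ) (g : minGens Γ) :
    g * u g ≤ factorizationHom Γ u := by
  classical
  rw [factorizationHom, Finsupp.liftAddHom_apply, Finsupp.sum]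
  by_cases h : g ∈ u.support
  · exact Finset.single_le_sum (f := fun i : minGens Γ => (i : ℕ) * u i) (fun _ _ => Nat.zero_le _) h
  · simp [Finsupp.notMem_support_iff.mp h]

theorem le_factorizationHom {Γ : AddSubmonoid ℕ} (u : minGens Γ →₀ ℕ) (g : minGens Γ) :
    u g ≤ factorizationHom Γ u :=
  (Nat.le_mul_of_pos_left _ (Nat.pos_of_ne_zero g.2.2.1)).trans (mul_le_factorizationHom u g)

theorem eq_zero_of_factorizationHom_eq_zero {Γ : AddSubmonoid ℕ} {u : minGens Γ →₀ ℕ}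
    (h : factorizationHom Γ u = 0) : u = 0 :=
  Finsupp.ext fun g => Nat.le_zero.mp (h ▸ le_factorizationHom u g)

/-- A minimal generator has only one factorization. -/
theorem eq_single_of_factorizationHom_eq {Γ : AddSubmonoid ℕ} {u : minGens Γ →₀ ℕ}
    {g : minGens Γ} (h : factorizationHom Γ u = g) : u = Finsupp.single g 1 := by
  have hu : u ≠ 0 := by
    rintro rfl
    exact g.2.2.1 (by simpa using h.symm)
  obtain ⟨x, v, rfl⟩ := Finsupp.exists_single_add_of_ne_zero hu
  rw [map_add, factorizationHom_single, mul_one] at h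
  by_cases hv : factorizationHom Γ v = 0
  · have hxg : x = g := Subtype.ext (by omega)
    rw [eq_zero_of_factorizationHom_eq_zero hv, hxg, add_zero]
  · exact absurd h.symm (g.2.2.2 x x.2.1 _ (factorizationHom_mem Γ v) x.2.2.1 hv)

theorem exists_factorizationHom_eq {Γ : AddSubmonoid ℕ} {n : ℕ} (hn : n ∈ Γ) :
    ∃ u, factorizationHom Γ u = n := by
  induction n using Nat.strong_induction_on with
  | _ n ih =>
  by_cases h0 : n = 0
  · exact ⟨0, by simp [h0]⟩
  by_cases hg : n ∈ minGens Γ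
  · exact ⟨Finsupp.single ⟨n, hg⟩ 1, by simp [factorizationHom_single]⟩
  · simp only [minGens, Set.mem_ofPred_eq, not_and, not_forall, not_not] at hg
    obtain ⟨a, ha, b, hb, ha0, hb0, rfl⟩ := hg hn h0
    obtain ⟨u, hu⟩ := ih a (by omega) ha
    obtain ⟨v, hv⟩ := ih b (by omega) hb
    exact ⟨u + v, by rw [map_add, hu, hv]⟩

theorem finite_factorizations {Γ : AddSubmonoid ℕ} (hfin : (minGens Γ).Finite) (n : ℕ) :
    {u | factorizationHom Γ u = n}.Finite := by
  have := hfin.to_subtype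
  refine (Set.finite_Iic (Finsupp.equivFunOnFinite.symm fun _ : minGens Γ => n)).subset ?_
  intro u hu g
  have h := le_factorizationHom u g
  rw [Set.mem_ofPred_eq.mp hu] at h
  simpa using h

theorem mult_mem_minGens {Γ : AddSubmonoid ℕ} (h : mult Γ ≠ 0) : mult Γ ∈ minGens Γ := by
  have hne : {g : ℕ | g ∈ Γ ∧ g ≠ 0}.Nonempty := by
    rw [Set.nonempty_iff_ne_empty]
    intro he
    exact h (by rw [mult, he, Nat.sInf_empty])
  have hm := Nat.sInf_mem hne
  refine ⟨hm.1, hm.2, fun a ha b hb ha0 hb0 hab => ?_⟩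
  have h1 : mult Γ ≤ a := Nat.sInf_le ⟨ha, ha0⟩
  omega

theorem mult_le {Γ : AddSubmonoid ℕ} {g : ℕ} (hg : g ∈ Γ) (h : g ≠ 0) : mult Γ ≤ g :=
  Nat.sInf_le ⟨hg, h⟩

/-- A factorization is normal if it is lexicographically largest among the factorizations of its
value. -/
def IsNormal {Γ : AddSubmonoid ℕ} (u : minGens Γ →₀ ℕ) : Prop :=
  ∀ v, factorizationHom Γ v = factorizationHom Γ u → toLex v ≤ toLex u

namespace IsNormal

variable {Γ : AddSubmonoid ℕ} {u v : minGens Γ →₀ ℕ}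

theorem of_add (h : IsNormal (u + v)) : IsNormal u := by
  intro w hw
  have := h (w + v) (by rw [map_add, map_add, hw])
  rw [toLex_add, toLex_add] at this
  exact le_of_add_le_add_right this

theorem mono (h : IsNormal u) (hvu : v ≤ u) : IsNormal v := by
  obtain ⟨w, rfl⟩ := le_iff_exists_add.mp hvu
  exact h.of_add

theorem eq_of_eq (hu : IsNormal u) (hv : IsNormal v)
    (h : factorizationHom Γ u = factorizationHom Γ v) : u = v :=
  toLex.injective (le_antisymm (hv u h) (hu v h.symm))

theorem single (g : minGens Γ) : IsNormal (Finsupp.single g 1) := by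
  intro v hv
  rw [factorizationHom_single, mul_one] at hv
  rw [eq_single_of_factorizationHom_eq hv]

theorem zero : IsNormal (0 : minGens Γ →₀ ℕ) := by
  intro v hv
  rw [map_zero] at hv
  rw [eq_zero_of_factorizationHom_eq_zero hv]

theorem single_add {g : minGens Γ} (hg : ∀ g' : minGens Γ, g ≤ g') (hu : IsNormal u) :
    IsNormal (Finsupp.single g 1 + u) := by
  intro v hv
  by_contra! hlt
  have hvg : v g ≠ 0 := by
    obtain ⟨i, hi, hi'⟩ := Finsupp.Lex.lt_iff.mp hlt
    simp only [ofLex_toLex, Finsupp.add_apply] at hi hi'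
    rcases (hg i).eq_or_lt with rfl | h
    · simp at hi'; omega
    · have := hi g h
      simp at this; omega
  obtain ⟨w, rfl⟩ := Finsupp.exists_single_add_of_apply_ne_zero hvg
  rw [map_add, map_add, add_right_inj] at hv
  rw [toLex_add, toLex_add, add_lt_add_iff_left] at hlt
  exact hlt.not_ge (hu w hv)

theorem single_nsmul_add {g : minGens Γ} (hg : ∀ g' : minGens Γ, g ≤ g') (hu : IsNormal u)
    (k : ℕ) : IsNormal (Finsupp.single g k + u) := by
  induction k with
  | zero => simpa
  | succ k ih =>
    rw [add_comm k 1, Finsupp.single_add, add_assoc]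
    exact single_add hg ih

end IsNormal

/-- The minimal non-normal factorizations. -/
def corners (Γ : AddSubmonoid ℕ) : Set (minGens Γ →₀ ℕ) :=
  {u | Minimal (fun v => ¬ IsNormal v) u}

theorem exists_isNormal {Γ : AddSubmonoid ℕ} (hfin : (minGens Γ).Finite) (u : minGens Γ →₀ ℕ) :
    ∃ v, factorizationHom Γ v = factorizationHom Γ u ∧ IsNormal v := by
  obtain ⟨v, hv, hmax⟩ := Set.exists_max_image _ toLex
    (finite_factorizations hfin (factorizationHom Γ u)) ⟨u, rfl⟩
  exact ⟨v, hv, fun w hw => hmax w (hw.trans hv)⟩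

theorem isNormal_of_lt_corner {Γ : AddSubmonoid ℕ} {u v : minGens Γ →₀ ℕ} (hu : u ∈ corners Γ)
    (hv : v < u) : IsNormal v :=
  by_contra fun h => hv.not_ge (hu.2 h hv.le)

/-- If there are finitely many corners, then one relation per corner generates the kernel
congruence. -/
theorem exists_presentation {Γ : AddSubmonoid ℕ} (hfin : (minGens Γ).Finite)
    (hc : (corners Γ).Finite) :
    ∃ R : Set ((minGens Γ →₀ ℕ) × (minGens Γ →₀ ℕ)), R.Finite ∧ R.ncard ≤ (corners Γ).ncard ∧
      addConGen (fun a b => (a, b) ∈ R) = AddCon.ker (factorizationHom Γ) := by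
  choose N hN hNn using exists_isNormal hfin
  refine ⟨(fun u => (u, N u)) '' corners Γ, hc.image _, Set.ncard_image_le hc, le_antisymm ?_ ?_⟩
  · rw [AddCon.addConGen_le]
    rintro a b ⟨u, -, h⟩
    obtain ⟨rfl, rfl⟩ := Prod.mk.inj h
    exact (hN u).symm
  · set c := addConGen (fun a b => (a, b) ∈ (fun u => (u, N u)) '' corners Γ) with hcdef
    have key : ∀ a, c a (N a) := by
      intro a
      obtain ⟨b, ⟨hb, hab⟩, hmax⟩ := Set.exists_max_image
        {b | factorizationHom Γ b = factorizationHom Γ a ∧ c a b} toLex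
        ((finite_factorizations hfin (factorizationHom Γ a)).subset fun b hb => hb.1)
        ⟨a, rfl, c.refl a⟩
      by_cases hbn : IsNormal b
      · rwa [hbn.eq_of_eq (hNn a) (hb.trans (hN a).symm)] at hab
      · exfalso
        obtain ⟨u, hub, hu⟩ := exists_minimal_le_of_wellFoundedLT (fun v => ¬ IsNormal v) b hbn
        obtain ⟨w, rfl⟩ := le_iff_exists_add.mp hub
        have h1 : c u (N u) := AddConGen.Rel.of _ _ ⟨u, hu, rfl⟩
        have h2 : toLex u < toLex (N u) := by
          refine lt_of_le_of_ne (hNn u u (hN u).symm) fun h => hu.1 ?_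
          rw [toLex.injective h]
          exact hNn u
        have h3 := hmax (N u + w) ⟨by rw [← hb, map_add, map_add, hN],
          c.trans hab (c.add h1 (c.refl w))⟩
        rw [toLex_add, toLex_add] at h3
        exact (le_of_add_le_add_right h3).not_gt h2
    intro a b hab
    have hab' : factorizationHom Γ a = factorizationHom Γ b := hab
    have : N a = N b := (hNn a).eq_of_eq (hNn b) (by rw [hN, hN, hab'])
    exact c.trans (key a) (this ▸ c.symm (key b))

section UpperBound

variable {Γ : AddSubmonoid ℕ} {m : minGens Γ}

theorem corner_apply_eq_zero (hm : ∀ g, m ≤ g) {u : minGens Γ →₀ ℕ} (hu : u ∈ corners Γ) :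
    u m = 0 := by
  by_contra h
  obtain ⟨v, rfl⟩ := Finsupp.exists_single_add_of_apply_ne_zero h
  exact hu.1 (IsNormal.single_add hm (isNormal_of_lt_corner hu (Finsupp.lt_single_add m v)))

theorem two_le_degree_of_mem_corners {u : minGens Γ →₀ ℕ} (hu : u ∈ corners Γ) :
    2 ≤ u.degree := by
  have hu0 : u ≠ 0 := by rintro rfl; exact hu.1 IsNormal.zero
  obtain ⟨x, v, rfl⟩ := Finsupp.exists_single_add_of_ne_zero hu0
  have hv : v ≠ 0 := by
    rintro rfl
    exact hu.1 (by simpa using IsNormal.single x)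
  have := (Finsupp.degree_eq_zero_iff v).not.mpr hv
  rw [map_add, Finsupp.degree_single]; omega

/-- The normal factorizations avoiding the generator `m` take distinct values modulo `m`. -/
theorem injOn_factorizationHom_mod (hm : ∀ g, m ≤ g) :
    Set.InjOn (fun u => factorizationHom Γ u % m) {u | IsNormal u ∧ u m = 0} := by
  have aux : ∀ u v : minGens Γ →₀ ℕ, IsNormal u → u m = 0 → IsNormal v → v m = 0 →
      factorizationHom Γ u ≤ factorizationHom Γ v →
      factorizationHom Γ u % m = factorizationHom Γ v % m → u = v := by
    intro u v hu hu0 hv hv0 hle hmod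
    obtain ⟨k, hk⟩ := (Nat.modEq_iff_dvd' hle).mp hmod
    have h : Finsupp.single m k + u = v :=
      (IsNormal.single_nsmul_add hm hu k).eq_of_eq hv (by
        rw [map_add, factorizationHom_single]; omega)
    have hk0 : k = 0 := by
      have := DFunLike.congr_fun h m
      simpa [hu0, hv0] using this
    simpa [hk0] using h
  intro u hu v hv h
  rcases le_total (factorizationHom Γ u) (factorizationHom Γ v) with hle | hle
  · exact aux u v hu.1 hu.2 hv.1 hv.2 hle h
  · exact (aux v u hv.1 hv.2 hu.1 hu.2 hle h.symm).symm

theorem finite_normal (hm : ∀ g, m ≤ g) :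
    {u : minGens Γ →₀ ℕ | IsNormal u ∧ u m = 0}.Finite := by
  refine Set.Finite.of_finite_image ((Set.finite_lt_nat (m : ℕ)).subset ?_)
    (injOn_factorizationHom_mod hm)
  rintro _ ⟨u, -, rfl⟩
  exact Nat.mod_lt _ (Nat.pos_of_ne_zero m.2.2.1)

theorem finset_card_le_of_normal (hm : ∀ g, m ≤ g) (S : Finset (minGens Γ →₀ ℕ))
    (hS : ∀ u ∈ S, IsNormal u ∧ u m = 0) : S.card ≤ m := by
  have : S.card ≤ (Finset.range m).card :=
    Finset.card_le_card_of_injOn (fun u => factorizationHom Γ u % m)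
      (fun u _ => by simpa using Nat.mod_lt _ (Nat.pos_of_ne_zero m.2.2.1))
      (fun u hu v hv h => injOn_factorizationHom_mod hm (hS u hu) (hS v hv) h)
  simpa using this

/-- The monomials of degree two in the generators other than `m`. -/
noncomputable def quadrics [Fintype (minGens Γ)] (m : minGens Γ) : Finset (minGens Γ →₀ ℕ) :=
  open Classical in (Finset.univ.erase m).sym2.image Finsupp.ofSym2

theorem card_quadrics [Fintype (minGens Γ)] (m : minGens Γ) :
    (quadrics m).card = (Fintype.card (minGens Γ)).choose 2 := by
  classical
  rw [quadrics, Finset.card_image_of_injective _ Finsupp.ofSym2_injective, Finset.card_sym2,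
    Finset.card_erase_of_mem (Finset.mem_univ m), Finset.card_univ,
    Nat.sub_add_cancel (Fintype.card_pos_iff.mpr ⟨m⟩)]

theorem mem_quadrics [Fintype (minGens Γ)] {m : minGens Γ} {u : minGens Γ →₀ ℕ} :
    u ∈ quadrics m ↔ u.degree = 2 ∧ u m = 0 := by
  classical
  rw [quadrics, Finset.mem_image]
  constructor
  · rintro ⟨p, hp, rfl⟩
    induction p using Sym2.ind with | _ a b
    rw [Finset.mk_mem_sym2_iff] at hp
    simp only [Finset.mem_erase] at hp
    simp [hp.1.1, hp.2.1]
  · rintro ⟨h2, h0⟩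
    obtain ⟨p, rfl⟩ := Finsupp.exists_ofSym2_of_degree_eq_two h2
    refine ⟨p, ?_, rfl⟩
    induction p using Sym2.ind with | _ a b
    rw [Finset.mk_mem_sym2_iff]
    simp only [Finsupp.ofSym2_mk, Finsupp.add_apply, Nat.add_eq_zero_iff] at h0
    constructor <;> simp only [Finset.mem_erase, Finset.mem_univ, and_true] <;> rintro rfl <;>
      simp at h0

theorem card_corners_le [Fintype (minGens Γ)] (hm : ∀ g, m ≤ g) {s : ℕ} (hs : s ≤ 5)
    (hms : (m : ℕ) = Fintype.card (minGens Γ) + s) (S : Finset (minGens Γ →₀ ℕ))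
    (hS : ∀ u ∈ S, u ∈ corners Γ) :
    S.card ≤ (Fintype.card (minGens Γ)).choose 2 + quadraticGrowth s - s := by
  classical
  have hfin := finite_normal hm
  set B := hfin.toFinset with hB
  have hmemB : ∀ u, u ∈ B ↔ IsNormal u ∧ u m = 0 := fun u => by simp [hB]
  set D := B.filter (fun u => 2 ≤ u.degree) with hD
  have hmemD : ∀ u, u ∈ D ↔ (IsNormal u ∧ u m = 0) ∧ 2 ≤ u.degree := fun u => by
    simp [hD, hmemB]
  have hDs : D.card ≤ s := by
    set G := (Finset.univ.erase m).image (fun g => Finsupp.single g 1) with hG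
    have hGc : G.card + 1 = Fintype.card (minGens Γ) := by
      rw [hG, Finset.card_image_of_injective _ (Finsupp.single_left_injective one_ne_zero),
        Finset.card_erase_of_mem (Finset.mem_univ m), Finset.card_univ,
        Nat.sub_add_cancel (Fintype.card_pos_iff.mpr ⟨m⟩)]
    have hG1 : ∀ u ∈ G, u.degree = 1 := by
      intro u hu
      obtain ⟨g, -, rfl⟩ := Finset.mem_image.mp hu
      simp
    have h0G : (0 : minGens Γ →₀ ℕ) ∉ G := fun h => by simpa using hG1 _ h
    have hdisj : Disjoint (insert 0 G) D := by
      rw [Finset.disjoint_left]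
      intro u hu huD
      have h2 := ((hmemD u).mp huD).2
      rcases Finset.mem_insert.mp hu with rfl | hu
      · simp at h2
      · have := hG1 u hu
        omega
    have hle := finset_card_le_of_normal hm (insert 0 G ∪ D) (by
      intro u hu
      simp only [Finset.mem_union, Finset.mem_insert] at hu
      rcases hu with (rfl | hu) | hu
      · exact ⟨IsNormal.zero, rfl⟩
      · obtain ⟨g, hg, rfl⟩ := Finset.mem_image.mp hu
        exact ⟨IsNormal.single g, by simp [(Finset.mem_erase.mp hg).1]⟩
      · exact ((hmemD u).mp hu).1)
    rw [Finset.card_union_of_disjoint hdisj, Finset.card_insert_of_notMem h0G] at hle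
    omega
  set T := (S.filter fun u => 3 ≤ u.degree) ∪ (D.filter fun u => 3 ≤ u.degree) with hT
  set Q := (S.filter fun u => ¬ 3 ≤ u.degree) ∪ (D.filter fun u => ¬ 3 ≤ u.degree) with hQ
  have hSD : Disjoint S D := by
    rw [Finset.disjoint_left]
    exact fun u hu hu' => (hS u hu).1 ((hmemD u).mp hu').1.1
  have hTcard : T.card ≤ quadraticGrowth D.card := by
    refine Finsupp.card_le_quadraticGrowth D T (by omega) (fun u hu => ((hmemD u).mp hu).2) ?_ ?_
    · intro u hu v hv h2
      obtain ⟨⟨hun, hu0⟩, -⟩ := (hmemD u).mp hu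
      exact (hmemD v).mpr ⟨⟨hun.mono hv, Nat.le_zero.mp (hu0 ▸ hv m)⟩, h2⟩
    · intro u hu
      simp only [hT, Finset.mem_union, Finset.mem_filter] at hu
      rcases hu with ⟨hu, h3⟩ | ⟨hu, h3⟩
      · refine ⟨h3, fun v hv h2 => (hmemD v).mpr ⟨⟨isNormal_of_lt_corner (hS u hu) hv, ?_⟩, h2⟩⟩
        exact Nat.le_zero.mp (corner_apply_eq_zero hm (hS u hu) ▸ hv.le m)
      · obtain ⟨⟨hun, hu0⟩, -⟩ := (hmemD u).mp hu
        exact ⟨h3, fun v hv h2 =>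
          (hmemD v).mpr ⟨⟨hun.mono hv.le, Nat.le_zero.mp (hu0 ▸ hv.le m)⟩, h2⟩⟩
  have hQcard : Q.card ≤ (Fintype.card (minGens Γ)).choose 2 := by
    rw [← card_quadrics m]
    refine Finset.card_le_card fun u hu => mem_quadrics.mpr ?_
    simp only [hQ, Finset.mem_union, Finset.mem_filter] at hu
    rcases hu with ⟨hu, h3⟩ | ⟨hu, h3⟩
    · have := two_le_degree_of_mem_corners (hS u hu)
      exact ⟨by omega, corner_apply_eq_zero hm (hS u hu)⟩
    · have := (hmemD u).mp hu
      exact ⟨by omega, this.1.2⟩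
  rw [hT, Finset.card_union_of_disjoint (Finset.disjoint_filter_filter hSD)] at hTcard
  rw [hQ, Finset.card_union_of_disjoint (Finset.disjoint_filter_filter hSD)] at hQcard
  have h1 := Finset.card_filter_add_card_filter_not (s := S) (fun u => 3 ≤ u.degree)
  have h2 := Finset.card_filter_add_card_filter_not (s := D) (fun u => 3 ≤ u.degree)
  have h3 := quadraticGrowth_sub_le hDs hs
  omega

theorem exists_presentation_card_le [Fintype (minGens Γ)] (hm : ∀ g, m ≤ g) {s : ℕ} (hs : s ≤ 5)
    (hms : (m : ℕ) = Fintype.card (minGens Γ) + s) :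
    ∃ R : Set ((minGens Γ →₀ ℕ) × (minGens Γ →₀ ℕ)), R.Finite ∧
      R.ncard ≤ (Fintype.card (minGens Γ)).choose 2 + quadraticGrowth s - s ∧
      addConGen (fun a b => (a, b) ∈ R) = AddCon.ker (factorizationHom Γ) := by
  have hcard := card_corners_le hm hs hms
  have hfin : (corners Γ).Finite := by
    by_contra hinf
    obtain ⟨S, hS, hSc⟩ := Set.Infinite.exists_subset_card_eq hinf
      ((Fintype.card (minGens Γ)).choose 2 + quadraticGrowth s - s + 1)
    have := hcard S fun u hu => hS hu
    omega
  obtain ⟨R, hR, hRc, hgen⟩ := exists_presentation (Set.toFinite _) hfin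
  refine ⟨R, hR, hRc.trans ?_, hgen⟩
  rw [Set.ncard_eq_toFinset_card _ hfin]
  exact hcard _ fun u hu => by simpa using hu

end UpperBound

section LowerBound

variable {Γ : AddSubmonoid ℕ}

/-- Monomials that share no variable with any other factorization of their value, and are not
the only such monomials in their fibre, contribute independent relations. -/
theorem card_le_ncard_of_isolated (U : Finset (minGens Γ →₀ ℕ))
    (hiso : ∀ u ∈ U, ∀ v, factorizationHom Γ v = factorizationHom Γ u →
      ∀ g, u g ≠ 0 → v g ≠ 0 → v = u)
    (hex : ∀ u ∈ U, ∃ v, v ∉ U ∧ factorizationHom Γ v = factorizationHom Γ u)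
    {R : Set ((minGens Γ →₀ ℕ) × (minGens Γ →₀ ℕ))} (hR : R.Finite)
    (hgen : addConGen (fun a b => (a, b) ∈ R) = AddCon.ker (factorizationHom Γ)) :
    U.card ≤ R.ncard := by
  classical
  let f : (minGens Γ →₀ ℕ) → ((minGens Γ →₀ ℕ) →₀ ℚ) :=
    fun a => if a ∈ U then Finsupp.single a 1 else 0
  let F : Finset ((minGens Γ →₀ ℕ) →₀ ℚ) := hR.toFinset.image fun p => f p.1 - f p.2
  let W := Submodule.span ℚ (F : Set ((minGens Γ →₀ ℕ) →₀ ℚ))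
  have hshift : ∀ a b c, factorizationHom Γ a = factorizationHom Γ b → c ≠ 0 →
      f (a + c) = f (b + c) := by
    intro a b c hab hc
    obtain ⟨g, hg⟩ := Finsupp.ne_iff.mp hc
    have hac : (a + c) g ≠ 0 := by simp at hg ⊢; omega
    have hbc : (b + c) g ≠ 0 := by simp at hg ⊢; omega
    have hval : factorizationHom Γ (a + c) = factorizationHom Γ (b + c) := by
      rw [map_add, map_add, hab]
    by_cases ha : a + c ∈ U
    · rw [hiso _ ha _ hval.symm g hac hbc]
    · by_cases hb : b + c ∈ U
      · rw [hiso _ hb _ hval g hbc hac]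
      · simp [f, ha, hb]
  have hadd : ∀ a b c, factorizationHom Γ a = factorizationHom Γ b → f a - f b ∈ W →
      f (a + c) - f (b + c) ∈ W := by
    intro a b c hab hW
    by_cases hc : c = 0
    · simpa [hc] using hW
    · rw [hshift a b c hab hc, sub_self]
      exact W.zero_mem
  let C : AddCon (minGens Γ →₀ ℕ) :=
    { r := fun a b => factorizationHom Γ a = factorizationHom Γ b ∧ f a - f b ∈ W
      iseqv :=
        { refl := fun a => ⟨rfl, by simp⟩
          symm := fun {a b} h => ⟨h.1.symm, by simpa using W.neg_mem h.2⟩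
          trans := fun {a b c} h h' => ⟨h.1.trans h'.1, by simpa using W.add_mem h.2 h'.2⟩ }
      add' := by
        rintro a b c d ⟨hab, hW⟩ ⟨hcd, hW'⟩
        refine ⟨by rw [map_add, map_add, hab, hcd], ?_⟩
        have h1 := hadd a b c hab hW
        have h2 := hadd c d b hcd hW'
        rw [add_comm c b, add_comm d b] at h2
        simpa using W.add_mem h1 h2 }
  have hker : AddCon.ker (factorizationHom Γ) ≤ C := by
    rw [← hgen, AddCon.addConGen_le]
    intro a b hab
    refine ⟨?_, Submodule.subset_span ?_⟩
    · have : AddCon.ker (factorizationHom Γ) a b := by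
        rw [← hgen]
        exact AddConGen.Rel.of _ _ hab
      exact this
    · simp only [F, Finset.coe_image, Set.mem_image, Finset.mem_coe, Set.Finite.mem_toFinset]
      exact ⟨(a, b), hab, rfl⟩
  have hsingle : ∀ u ∈ U, Finsupp.single u (1 : ℚ) ∈ W := by
    intro u hu
    obtain ⟨v, hv, huv⟩ := hex u hu
    have := (hker (x := u) (y := v) huv.symm).2
    simpa [f, hu, hv] using this
  have hli : LinearIndependent ℚ fun u : U => (⟨Finsupp.single u.1 1, hsingle u.1 u.2⟩ : W) := by
    refine LinearIndependent.of_comp W.subtype ?_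
    exact (Finsupp.linearIndependent_single_one ℚ (minGens Γ →₀ ℕ)).comp Subtype.val
      Subtype.val_injective
  have h1 := hli.fintype_card_le_finrank
  have h2 : Module.finrank ℚ W ≤ F.card := finrank_span_finset_le_card F
  have h3 : F.card ≤ hR.toFinset.card := Finset.card_image_le
  rw [Fintype.card_coe] at h1
  rw [Set.ncard_eq_toFinset_card _ hR]
  omega

end LowerBound

theorem choose_two_add_card_le_ncard {Γ : AddSubmonoid ℕ} [Fintype (minGens Γ)] (m : minGens Γ)
    (D T : Finset (minGens Γ →₀ ℕ))
    (hQ : ∀ u ∈ quadrics m, u ∉ D → ∃ v, v m ≠ 0 ∧ factorizationHom Γ v = factorizationHom Γ u)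
    (hD : ∀ d ∈ D, ∀ v, factorizationHom Γ v = factorizationHom Γ d → v = d)
    (hT : ∀ t ∈ T, ∃ a b c, a ≠ m ∧ b ≠ m ∧ c ≠ m ∧
      t = Finsupp.single a 1 + Finsupp.single b 1 + Finsupp.single c 1 ∧
      Finsupp.ofSym2 s(b, c) ∈ D ∧ Finsupp.ofSym2 s(a, c) ∈ D ∧ Finsupp.ofSym2 s(a, b) ∈ D)
    (hT' : ∀ t ∈ T, ∃ v, v m ≠ 0 ∧ factorizationHom Γ v = factorizationHom Γ t)
    {R : Set ((minGens Γ →₀ ℕ) × (minGens Γ →₀ ℕ))} (hR : R.Finite)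
    (hgen : addConGen (fun a b => (a, b) ∈ R) = AddCon.ker (factorizationHom Γ)) :
    (Fintype.card (minGens Γ)).choose 2 + T.card ≤ R.ncard + D.card := by
  classical
  have hTm : ∀ t ∈ T, t.degree = 3 ∧ t m = 0 := by
    intro t ht
    obtain ⟨a, b, c, ha, hb, hc, rfl, -⟩ := hT t ht
    simp [ha, hb, hc]
  have hUm : ∀ u ∈ (quadrics m \ D) ∪ T, u m = 0 := by
    intro u hu
    rcases Finset.mem_union.mp hu with hu | hu
    · exact (mem_quadrics.mp (Finset.mem_sdiff.mp hu).1).2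
    · exact (hTm u hu).2
  have hcancel : ∀ (g : minGens Γ) (d v : minGens Γ →₀ ℕ),
      (∀ w, factorizationHom Γ w = factorizationHom Γ d → w = d) → v g ≠ 0 →
      factorizationHom Γ v = factorizationHom Γ (Finsupp.single g 1 + d) →
      v = Finsupp.single g 1 + d := by
    intro g d v hd hv h
    obtain ⟨w, rfl⟩ := Finsupp.exists_single_add_of_apply_ne_zero hv
    rw [map_add, map_add, add_right_inj] at h
    rw [hd w h]
  have hle := card_le_ncard_of_isolated ((quadrics m \ D) ∪ T) ?_ ?_ hR hgen
  · rw [Finset.card_union_of_disjoint] at hle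
    · have h1 := Finset.le_card_sdiff D (quadrics m)
      rw [card_quadrics] at h1
      omega
    · rw [Finset.disjoint_left]
      intro u hu hu'
      have h2 := (mem_quadrics.mp (Finset.mem_sdiff.mp hu).1).1
      have h3 := (hTm u hu').1
      omega
  · intro u hu v hv g hug hvg
    rcases Finset.mem_union.mp hu with hu | hu
    · obtain ⟨w, rfl⟩ := Finsupp.exists_single_add_of_apply_ne_zero hug
      have h2 := (mem_quadrics.mp (Finset.mem_sdiff.mp hu).1).1
      rw [map_add, Finsupp.degree_single] at h2
      have hw : w ≠ 0 := by rintro rfl; simp at h2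
      obtain ⟨h, w', rfl⟩ := Finsupp.exists_single_add_of_ne_zero hw
      rw [map_add, Finsupp.degree_single] at h2
      have hw' : w' = 0 := (Finsupp.degree_eq_zero_iff w').mp (by omega)
      subst hw'
      rw [add_zero] at hv ⊢
      refine hcancel g _ v (fun w hw => ?_) hvg hv
      rw [factorizationHom_single, mul_one] at hw
      exact eq_single_of_factorizationHom_eq hw
    · obtain ⟨a, b, c, -, -, -, rfl, hbc, hac, hab⟩ := hT u hu
      have hg : g = a ∨ g = b ∨ g = c := by
        by_contra! hne
        simp [hne.1, hne.2.1, hne.2.2] at hug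
      rcases hg with rfl | rfl | rfl
      · rw [add_assoc] at hv ⊢
        exact hcancel _ _ v (hD _ hbc) hvg hv
      · rw [add_assoc, add_left_comm] at hv ⊢
        exact hcancel _ _ v (hD _ hac) hvg hv
      · rw [add_comm] at hv ⊢
        exact hcancel _ _ v (hD _ hab) hvg hv
  · intro u hu
    have : ∃ v, v m ≠ 0 ∧ factorizationHom Γ v = factorizationHom Γ u := by
      rcases Finset.mem_union.mp hu with hu' | hu'
      · exact hQ u (Finset.mem_sdiff.mp hu').1 (Finset.mem_sdiff.mp hu').2
      · exact hT' u hu'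
    obtain ⟨v, hv, hvu⟩ := this
    exact ⟨v, fun h => hv (hUm v h), hvu⟩

theorem macUpper_one (n : ℕ) : macUpper 1 n = (n + 1).choose 2 := by
  rw [macUpper]
  split_ifs with h
  · simp [h]
  · have : sSup {a : ℕ | a.choose (0 + 1) ≤ n} = n := by
      simp only [zero_add, Nat.choose_one_right]
      exact csSup_Iic
    rw [this]
    simp [macUpper]

theorem sSup_choose_two_le {n a : ℕ} (h : a.choose 2 ≤ n) (h' : n < (a + 1).choose 2) :
    sSup {a : ℕ | a.choose (1 + 1) ≤ n} = a := by
  refine IsGreatest.csSup_eq ⟨h, fun b hb => ?_⟩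
  by_contra! hlt
  have := Nat.choose_le_choose 2 (show a + 1 ≤ b from hlt)
  exact absurd (show b.choose 2 ≤ n from hb) (by omega)

theorem macUpper_two {s : ℕ} (hs : s ≤ 5) : macUpper 2 s = quadraticGrowth s := by
  rw [macUpper]
  interval_cases s
  · rfl
  · rw [sSup_choose_two_le (a := 2) (by decide) (by decide), macUpper_one]; rfl
  · rw [sSup_choose_two_le (a := 2) (by decide) (by decide), macUpper_one]; rfl
  · rw [sSup_choose_two_le (a := 3) (by decide) (by decide), macUpper_one]; rfl
  · rw [sSup_choose_two_le (a := 3) (by decide) (by decide), macUpper_one]; rfl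
  · rw [sSup_choose_two_le (a := 3) (by decide) (by decide), macUpper_one]; rfl

theorem macR_eq_two {e m : ℕ} (h : e < m) (h' : m < (e + 2).choose 2) : macR e m = 2 := by
  refine IsLeast.csInf_eq ⟨⟨by norm_num, h'⟩, fun r hr => ?_⟩
  obtain ⟨hr0, hr⟩ := hr
  by_contra! hlt
  obtain rfl : r = 1 := by omega
  rw [Nat.choose_one_right] at hr
  omega

theorem mathcalC_eq {e m s : ℕ} (he : 3 ≤ e) (hm : m = e + 1 + s) (hs : s ≤ 5) :
    mathcalC e m = (e + 1).choose 2 + quadraticGrowth s - s := by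
  have hlt : m < (e + 2).choose 2 := by
    have h1 : (e + 2).choose 2 = (e + 1) + (e + (3 - 3 + e).choose 2) := by
      rw [Nat.choose_succ_succ' (e + 1) 1, Nat.choose_succ_succ' e 1]
      simp
    have h2 : (3 : ℕ).choose 2 ≤ (3 - 3 + e).choose 2 := Nat.choose_le_choose 2 (by omega)
    have h3 : (3 : ℕ).choose 2 = 3 := rfl
    omega
  have hr := macR_eq_two (by omega) hlt
  have hsub : m - (e + 2 - 1).choose (2 - 1) = s := by
    simp; omega
  rw [mathcalC, hr, hsub, macUpper_two hs]
  rfl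

theorem ncard_eq_of_mem_iff {P : Set ℕ} (A E : List ℕ) {a b : ℕ} (hA : A.Nodup) (hE : E.Nodup)
    (hAa : ∀ n ∈ A, n < a) (hEab : ∀ n ∈ E, a ≤ n ∧ n < b)
    (hP : ∀ n, n ∈ P ↔ n ∈ A ∨ (a ≤ n ∧ n < b ∧ n ∉ E)) :
    P.ncard = A.length + (b - a - E.length) := by
  have : P = ↑(A.toFinset ∪ (Finset.Ico a b \ E.toFinset)) := by
    ext n
    simp [hP, and_assoc]
  rw [this, Set.ncard_coe_finset, Finset.card_union_of_disjoint, List.toFinset_card_of_nodup hA,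
    Finset.card_sdiff_of_subset, List.toFinset_card_of_nodup hE, Nat.card_Ico]
  · intro n hn
    simpa using hEab n (List.mem_toFinset.mp hn)
  · rw [Finset.disjoint_left]
    intro n hn hn'
    have h1 := hAa n (List.mem_toFinset.mp hn)
    have h2 := (Finset.mem_Ico.mp (Finset.mem_sdiff.mp hn').1).1
    omega

/-- The integers at least `4 * m + 1` excluded from `extremalMonoid m s`. -/
def IsExtremalGap (m s n : ℕ) : Prop :=
  (1 ≤ s ∧ (n = 4 * m + 4 ∨ n = 5 * m + 4)) ∨ (2 ≤ s ∧ (n = 4 * m + 5 ∨ n = 5 * m + 5)) ∨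
    (3 ≤ s ∧ (n = 4 * m + 6 ∨ n = 5 * m + 6)) ∨ (4 ≤ s ∧ (n = 4 * m + 1 ∨ n = 5 * m + 1)) ∨
    (s = 4 ∧ n = 6 * m + 1) ∨ (s = 5 ∧ n + 2 = 5 * m)

/-- Membership in `extremalMonoid m s`. -/
def IsExtremalMem (m s n : ℕ) : Prop :=
  n = 0 ∨ n = m ∨ n = 2 * m ∨ n = 3 * m ∨ n = 4 * m ∨ n = 3 * m + 2 ∨ n = 3 * m + 3 ∨
    (s = 5 ∧ n + 1 = 3 * m) ∨ (4 ≤ s ∧ n + 1 = 4 * m) ∨ (4 * m + 1 ≤ n ∧ ¬ IsExtremalGap m s n)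

/-- The minimal generators of `extremalMonoid m s` other than `m`. -/
def IsExtremalGen (m s n : ℕ) : Prop :=
  n = 3 * m + 2 ∨ n = 3 * m + 3 ∨ (s = 5 ∧ n + 1 = 3 * m) ∨ (s = 4 ∧ n + 1 = 4 * m) ∨
    (4 * m + 1 ≤ n ∧ n < 5 * m ∧ n ≠ 4 * m + 2 ∧ n ≠ 4 * m + 3 ∧ ¬ IsExtremalGap m s n ∧
      ¬ (4 ≤ s ∧ n + 1 = 5 * m))

section Arithmetic

variable {m s : ℕ}

theorem IsExtremalMem.add (hs : s ≤ 5) (hm : s + 4 ≤ m) {a b : ℕ} (ha : IsExtremalMem m s a)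
    (hb : IsExtremalMem m s b) : IsExtremalMem m s (a + b) := by
  wlog hab : a ≤ b generalizing a b
  · rw [add_comm]; exact this hb ha (by omega)
  simp only [IsExtremalMem, IsExtremalGap] at *
  rcases ha with ha | ha | ha | ha | ha | ha | ha | ha | ha | ha <;>
  rcases hb with hb | hb | hb | hb | hb | hb | hb | hb | hb | hb <;> omega

theorem IsExtremalGen.mem (hs : s ≤ 5) (hm : s + 4 ≤ m) {n : ℕ} (h : IsExtremalGen m s n) :
    IsExtremalMem m s n := by
  simp only [IsExtremalGen, IsExtremalMem, IsExtremalGap] at *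
  omega

theorem IsExtremalMem.of_not_gap {n : ℕ} (h : 4 * m + 1 ≤ n) (hn : ¬ IsExtremalGap m s n) :
    IsExtremalMem m s n := by
  simp only [IsExtremalMem]
  tauto

theorem IsExtremalGen.lower_bound {n : ℕ} (h : IsExtremalGen m s n) :
    n = 3 * m + 2 ∨ n = 3 * m + 3 ∨ (s = 5 ∧ n + 1 = 3 * m) ∨ (s = 4 ∧ n + 1 = 4 * m) ∨
      4 * m + 1 ≤ n := by
  simp only [IsExtremalGen] at h
  tauto

theorem IsExtremalMem.lower_bound {n : ℕ} (h : IsExtremalMem m s n) (h0 : n ≠ 0) :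
    n = m ∨ n = 2 * m ∨ 3 * m ≤ n + 1 := by
  simp only [IsExtremalMem] at h
  omega

theorem IsExtremalGen.ne_add (hs : s ≤ 5) (hm : s + 4 ≤ m) {n a b : ℕ}
    (h : n = m ∨ IsExtremalGen m s n) (ha : IsExtremalMem m s a) (hb : IsExtremalMem m s b)
    (ha0 : a ≠ 0) (hb0 : b ≠ 0) : n ≠ a + b := by
  wlog hab : a ≤ b generalizing a b
  · rw [add_comm]; exact this hb ha hb0 ha0 (by omega)
  have hal := ha.lower_bound ha0
  rcases h with rfl | h
  · omega
  · rintro rfl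
    have hlt : a + b < 5 * m := by simp only [IsExtremalGen] at h; omega
    simp only [IsExtremalGen] at h
    simp only [IsExtremalMem] at hb
    have hal' : a = m ∨ a = 2 * m := by omega
    clear ha hal hlt
    rcases hal' with rfl | rfl <;>
    rcases hb with hb | hb | hb | hb | hb | hb | hb | hb | hb | ⟨hb, hg⟩ <;>
    rcases h with h | h | h | h | ⟨h1, h2, h3, h4, h5, h6⟩ <;> omega

theorem IsExtremalGap.eq_add_of_not_gap (hs : s ≤ 5) (hm : s + 4 ≤ m) {n : ℕ} (hn : 5 * m + 1 ≤ n)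
    (hg : IsExtremalGap m s (n - m)) (hng : ¬ IsExtremalGap m s n) :
    n = (3 * m + 2) + (3 * m + 2) ∨ n = (3 * m + 2) + (3 * m + 3) ∨
      n = (3 * m + 3) + (3 * m + 3) ∨ (s = 5 ∧ n = (3 * m + 2) + (3 * m - 1)) ∨
      (s = 5 ∧ n = (3 * m - 1) + (3 * m - 1)) ∨ (s = 4 ∧ n = (3 * m + 2) + (4 * m - 1)) := by
  obtain ⟨k, rfl⟩ := Nat.exists_eq_add_of_le (show m ≤ n by omega)
  rw [Nat.add_sub_cancel_left] at hg
  rcases hg with ⟨h, rfl | rfl⟩ | ⟨h, rfl | rfl⟩ | ⟨h, rfl | rfl⟩ | ⟨h, rfl | rfl⟩ | ⟨h, rfl⟩ |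
    ⟨h, hk⟩
  · exact absurd (Or.inl ⟨h, Or.inr (by omega)⟩) hng
  · left; omega
  · exact absurd (Or.inr (Or.inl ⟨h, Or.inr (by omega)⟩)) hng
  · right; left; omega
  · exact absurd (Or.inr (Or.inr (Or.inl ⟨h, Or.inr (by omega)⟩))) hng
  · right; right; left; omega
  · exact absurd (Or.inr (Or.inr (Or.inr (Or.inl ⟨h, Or.inr (by omega)⟩)))) hng
  · rcases eq_or_ne s 4 with rfl | h4
    · exact absurd (Or.inr (Or.inr (Or.inr (Or.inr (Or.inl ⟨rfl, by omega⟩))))) hng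
    · right; right; right; left; omega
  · right; right; right; right; right; omega
  · right; right; right; right; left; omega

theorem IsExtremalMem.exists_add (hs : s ≤ 5) (hm : s + 4 ≤ m) {n : ℕ}
    (h : IsExtremalMem m s n) (h0 : n ≠ 0) (hnm : n ≠ m) (hn : ¬ IsExtremalGen m s n) :
    ∃ a b, IsExtremalMem m s a ∧ IsExtremalMem m s b ∧ a ≠ 0 ∧ b ≠ 0 ∧ n = a + b := by
  have hmm : IsExtremalMem m s m := by simp [IsExtremalMem]
  have hx : IsExtremalMem m s (3 * m + 2) := by simp [IsExtremalMem]
  have hy : IsExtremalMem m s (3 * m + 3) := by simp [IsExtremalMem]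
  by_cases hd : m ≤ n ∧ IsExtremalMem m s (n - m)
  · exact ⟨m, n - m, hmm, hd.2, by omega, by omega, by omega⟩
  have hgap : 5 * m + 1 ≤ n → IsExtremalGap m s (n - m) := by
    intro hle
    by_contra hg
    exact hd ⟨by omega, IsExtremalMem.of_not_gap (by omega) hg⟩
  have hn5 : 5 * m + 1 ≤ n := by
    by_contra hlt
    simp only [IsExtremalGen, not_or] at hn
    simp only [IsExtremalMem, not_and_or, not_or] at h hd
    obtain ⟨hn1, hn2, hn3, hn4, hn5⟩ := hn
    rcases h with h | h | h | h | h | h | h | h | h | ⟨h, hg⟩ <;> try omega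
    by_cases h' : n = 4 * m + 2 ∨ n = 4 * m + 3 ∨ n = 5 * m
    · omega
    · have : 4 ≤ s ∧ n + 1 = 5 * m := by
        by_contra hh
        exact hn5 ⟨h, by omega, by omega, by omega, hg, hh⟩
      simp only [IsExtremalGap] at hg
      omega
  have hng : ¬ IsExtremalGap m s n := by
    simp only [IsExtremalMem] at h
    rcases h with h | h | h | h | h | h | h | h | h | ⟨h, hg⟩ <;> omega
  have key := IsExtremalGap.eq_add_of_not_gap hs hm hn5 (hgap hn5) hng
  rcases key with h | h | h | ⟨hs5, h⟩ | ⟨hs5, h⟩ | ⟨hs4, h⟩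
  · exact ⟨_, _, hx, hx, by omega, by omega, h⟩
  · exact ⟨_, _, hx, hy, by omega, by omega, h⟩
  · exact ⟨_, _, hy, hy, by omega, by omega, h⟩
  · exact ⟨_, _, hx, by simp only [IsExtremalMem]; omega, by omega, by omega, h⟩
  · exact ⟨_, _, by simp only [IsExtremalMem]; omega, by simp only [IsExtremalMem]; omega,
      by omega, by omega, h⟩
  · exact ⟨_, _, hx, by simp only [IsExtremalMem]; omega, by omega, by omega, h⟩

/-- The pairs of generators whose sum lies in the Apéry set. -/
def IsExtremalPair (m s a b : ℕ) : Prop :=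
  (1 ≤ s ∧ a = 3 * m + 2 ∧ b = 3 * m + 2) ∨ (2 ≤ s ∧ a = 3 * m + 2 ∧ b = 3 * m + 3) ∨
    (3 ≤ s ∧ a = 3 * m + 3 ∧ b = 3 * m + 3) ∨ (s = 4 ∧ a = 3 * m + 2 ∧ b + 1 = 4 * m) ∨
    (s = 5 ∧ a = 3 * m + 2 ∧ b + 1 = 3 * m) ∨ (s = 5 ∧ a + 1 = 3 * m ∧ b + 1 = 3 * m)

theorem IsExtremalGen.sub_mem (hs : s ≤ 5) (hm : s + 4 ≤ m) {a b : ℕ}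
    (ha : IsExtremalGen m s a) (hb : IsExtremalGen m s b) (hab : ¬ IsExtremalPair m s a b)
    (hba : ¬ IsExtremalPair m s b a) : IsExtremalMem m s (a + b - m) := by
  wlog hle : a ≤ b generalizing a b
  · rw [add_comm]; exact this hb ha hba hab (by omega)
  have hal := ha.lower_bound
  have hbl := hb.lower_bound
  clear ha hb
  refine IsExtremalMem.of_not_gap (by omega) fun hg => ?_
  rcases lt_or_ge (4 * m) b with hb | hb
  · clear hab hba hbl
    simp only [IsExtremalGap] at hg
    omega
  · obtain ⟨n, hn⟩ : ∃ n, a + b = m + n := ⟨a + b - m, by omega⟩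
    rw [hn, Nat.add_sub_cancel_left] at hg
    simp only [IsExtremalGap] at hg
    rcases hal with rfl | rfl | ⟨rfl, ha⟩ | ⟨rfl, ha⟩ | ha <;>
    rcases hbl with rfl | rfl | ⟨hs5, hb'⟩ | ⟨hs4, hb'⟩ | hb' <;> try omega
    · exact hab (Or.inl ⟨by omega, rfl, rfl⟩)
    · exact hab (Or.inr (Or.inl ⟨by omega, rfl, rfl⟩))
    · exact hab (Or.inr (Or.inr (Or.inr (Or.inl ⟨hs4, rfl, hb'⟩))))
    · exact hab (Or.inr (Or.inr (Or.inl ⟨by omega, rfl, rfl⟩)))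
    · exact hba (Or.inr (Or.inr (Or.inr (Or.inr (Or.inl ⟨rfl, rfl, ha⟩)))))
    · exact hab (Or.inr (Or.inr (Or.inr (Or.inr (Or.inr ⟨rfl, ha, hb'⟩)))))

theorem IsExtremalPair.not_sub_mem (hs : s ≤ 5) (hm : s + 4 ≤ m) {a b : ℕ}
    (h : IsExtremalPair m s a b) : ¬ IsExtremalMem m s (a + b - m) := by
  simp only [IsExtremalPair, IsExtremalMem, IsExtremalGap] at *
  rcases h with h | h | h | h | h | h <;> omega

theorem IsExtremalPair.unique (hs : s ≤ 5) (hm : s + 4 ≤ m) {a b c d w : ℕ}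
    (h : IsExtremalPair m s a b) (hc : IsExtremalGen m s c) (hd : IsExtremalGen m s d)
    (hw : IsExtremalMem m s w) (heq : c + d + w = a + b) :
    w = 0 ∧ (c = a ∧ d = b ∨ c = b ∧ d = a) := by
  have hwm : w = 0 ∨ m ≤ w := by
    simp only [IsExtremalMem] at hw
    omega
  simp only [IsExtremalPair, IsExtremalGen, IsExtremalGap] at *
  rcases h with h | h | h | h | h | h <;> rcases hc with hc | hc | hc | hc | hc <;>
    rcases hd with hd | hd | hd | hd | hd <;> omega

theorem IsExtremalPair.gen (hs : s ≤ 5) {a b : ℕ} (h : IsExtremalPair m s a b) :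
    IsExtremalGen m s a ∧ IsExtremalGen m s b := by
  simp only [IsExtremalPair, IsExtremalGen] at *
  omega

theorem IsExtremalGen.three_sub_mem (hs : s ≤ 5) (hm : s + 4 ≤ m) {a b c : ℕ}
    (ha : IsExtremalGen m s a) (hb : IsExtremalGen m s b) (hc : IsExtremalGen m s c) :
    IsExtremalMem m s (a + b + c - m) := by
  have aux : ∀ n, IsExtremalGen m s n → 3 * m + 2 ≤ n ∨ s = 5 ∧ n + 1 = 3 * m := by
    intro n hn
    simp only [IsExtremalGen] at hn
    omega
  have h1 := aux a ha
  have h2 := aux b hb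
  have h3 := aux c hc
  simp only [IsExtremalMem, IsExtremalGap]
  omega

end Arithmetic

/-- A numerical monoid of multiplicity `m` whose Apéry set has exactly `s` nonzero elements that
are not generators, all of them sums of two generators in a unique way. -/
def extremalMonoid (m s : ℕ) (hs : s ≤ 5) (hm : s + 4 ≤ m) : AddSubmonoid ℕ where
  carrier := {n | IsExtremalMem m s n}
  add_mem' := fun ha hb => IsExtremalMem.add hs hm ha hb
  zero_mem' := Or.inl rfl

section ExtremalMonoid

variable {m s : ℕ} (hs : s ≤ 5) (hm : s + 4 ≤ m)

theorem mem_extremalMonoid {n : ℕ} : n ∈ extremalMonoid m s hs hm ↔ IsExtremalMem m s n := Iff.rfl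

theorem mem_minGens_extremalMonoid {n : ℕ} :
    n ∈ minGens (extremalMonoid m s hs hm) ↔ n = m ∨ IsExtremalGen m s n := by
  constructor
  · rintro ⟨h, h0, hadd⟩
    by_contra! hn
    obtain ⟨a, b, ha, hb, ha0, hb0, hab⟩ := IsExtremalMem.exists_add hs hm h h0 hn.1 hn.2
    exact hadd a ha b hb ha0 hb0 hab
  · intro h
    refine ⟨?_, ?_, fun a ha b hb ha0 hb0 => IsExtremalGen.ne_add hs hm h ha hb ha0 hb0⟩
    · rcases h with rfl | h
      · exact Or.inr (Or.inl rfl)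
      · exact h.mem hs hm
    · simp only [IsExtremalGen] at h
      omega

theorem isNumericalMonoid_extremalMonoid : IsNumericalMonoid (extremalMonoid m s hs hm) := by
  refine (Set.finite_lt_nat (7 * m)).subset fun n hn => ?_
  by_contra hlt
  simp only [Set.mem_ofPred_eq, not_lt] at hlt
  refine hn ?_
  simp only [SetLike.mem_coe, mem_extremalMonoid, IsExtremalMem, IsExtremalGap]
  omega

theorem mult_extremalMonoid : mult (extremalMonoid m s hs hm) = m := by
  refine IsLeast.csInf_eq ⟨⟨Or.inr (Or.inl rfl), by omega⟩, fun n hn => ?_⟩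
  obtain ⟨hn, h0⟩ := hn
  simp only [mem_extremalMonoid, IsExtremalMem] at hn
  omega

theorem edim_extremalMonoid : edim (extremalMonoid m s hs hm) = m - s := by
  have hmem := @mem_minGens_extremalMonoid m s hs hm
  simp only [IsExtremalGen, IsExtremalGap] at hmem
  rw [edim]
  interval_cases s
  · rw [ncard_eq_of_mem_iff [m, 3 * m + 2, 3 * m + 3] [4 * m + 2, 4 * m + 3] (a := 4 * m + 1)
      (b := 5 * m)] <;> simp [hmem] <;> omega
  · rw [ncard_eq_of_mem_iff [m, 3 * m + 2, 3 * m + 3] [4 * m + 2, 4 * m + 3, 4 * m + 4]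
      (a := 4 * m + 1) (b := 5 * m)] <;> simp [hmem] <;> omega
  · rw [ncard_eq_of_mem_iff [m, 3 * m + 2, 3 * m + 3] [4 * m + 2, 4 * m + 3, 4 * m + 4, 4 * m + 5]
      (a := 4 * m + 1) (b := 5 * m)] <;> simp [hmem] <;> omega
  · rw [ncard_eq_of_mem_iff [m, 3 * m + 2, 3 * m + 3]
      [4 * m + 2, 4 * m + 3, 4 * m + 4, 4 * m + 5, 4 * m + 6]
      (a := 4 * m + 1) (b := 5 * m)] <;> simp [hmem] <;> omega
  · rw [ncard_eq_of_mem_iff [m, 3 * m + 2, 3 * m + 3, 4 * m - 1]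
      [4 * m + 2, 4 * m + 3, 4 * m + 4, 4 * m + 5, 4 * m + 6, 4 * m + 1, 5 * m - 1]
      (a := 4 * m + 1) (b := 5 * m)] <;> simp [hmem] <;> omega
  · rw [ncard_eq_of_mem_iff [m, 3 * m + 2, 3 * m + 3, 3 * m - 1]
      [4 * m + 2, 4 * m + 3, 4 * m + 4, 4 * m + 5, 4 * m + 6, 4 * m + 1, 5 * m - 1, 5 * m - 2]
      (a := 4 * m + 1) (b := 5 * m)] <;> simp [hmem] <;> omega

end ExtremalMonoid

/-- The unordered version of `IsExtremalPair`. -/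
def IsExtremalEdge (m s a b : ℕ) : Prop :=
  IsExtremalPair m s a b ∨ IsExtremalPair m s b a

section LowerBound

variable {m s : ℕ}

theorem exists_factorization_apply_ne_zero {Γ : AddSubmonoid ℕ} (g : minGens Γ) {n : ℕ}
    (hn : g ≤ n) (h : n - g ∈ Γ) : ∃ v, v g ≠ 0 ∧ factorizationHom Γ v = n := by
  obtain ⟨w, hw⟩ := exists_factorizationHom_eq h
  refine ⟨Finsupp.single g 1 + w, by simp, ?_⟩
  rw [map_add, factorizationHom_single, mul_one, hw, Nat.add_sub_cancel' hn]

variable (hs : s ≤ 5) (hm : s + 4 ≤ m)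

theorem IsExtremalEdge.factorization_unique
    {a b : minGens (extremalMonoid m s hs hm)} (h : IsExtremalEdge m s a b)
    {v : minGens (extremalMonoid m s hs hm) →₀ ℕ} (hv : factorizationHom _ v = a + b) :
    v = Finsupp.single a 1 + Finsupp.single b 1 := by
  wlog hab : IsExtremalPair m s a b generalizing a b
  · rw [add_comm]
    exact this h.symm (by rw [hv, add_comm]) (h.resolve_left hab)
  clear h
  have hgen : ∀ g : minGens (extremalMonoid m s hs hm), v g ≠ 0 → IsExtremalGen m s g := by
    intro g hg
    refine ((mem_minGens_extremalMonoid hs hm).mp g.2).resolve_left fun hgm => ?_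
    obtain ⟨w, rfl⟩ := Finsupp.exists_single_add_of_apply_ne_zero hg
    rw [map_add, factorizationHom_single, mul_one, hgm] at hv
    refine hab.not_sub_mem hs hm ?_
    rw [← hv, Nat.add_sub_cancel_left]
    exact factorizationHom_mem _ w
  have hv0 : v ≠ 0 := by
    rintro rfl
    have := a.2.2.1
    simp only [map_zero] at hv
    omega
  obtain ⟨c, v, rfl⟩ := Finsupp.exists_single_add_of_ne_zero hv0
  rw [map_add, factorizationHom_single, mul_one] at hv
  have hv1 : v ≠ 0 := by
    rintro rfl
    rw [map_zero, add_zero] at hv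
    exact c.2.2.2 a a.2.1 b b.2.1 a.2.2.1 b.2.2.1 hv
  obtain ⟨d, v, rfl⟩ := Finsupp.exists_single_add_of_ne_zero hv1
  rw [map_add, factorizationHom_single, mul_one, ← add_assoc] at hv
  obtain ⟨hw, hcd⟩ := hab.unique hs hm (hgen c (by simp)) (hgen d (by simp))
    (factorizationHom_mem _ v) hv
  rw [eq_zero_of_factorizationHom_eq_zero hw, add_zero]
  rcases hcd with ⟨h1, h2⟩ | ⟨h1, h2⟩
  · rw [Subtype.ext h1, Subtype.ext h2]
  · rw [Subtype.ext h1, Subtype.ext h2, add_comm]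

theorem card_le_of_forall_isExtremalEdge {m s : ℕ} (hs : s ≤ 5) (S : Finset ℕ)
    (hS : ∀ n ∈ S, ∃ a b, IsExtremalEdge m s a b ∧ n = a + b) : S.card ≤ s := by
  have hsum : ∀ n ∈ S, n ∈ (Finset.range s).image (fun i =>
      if i < 3 then 6 * m + 4 + i else if s = 4 then 7 * m + 1 else if i = 3 then 6 * m + 1
      else 6 * m - 2) := by
    intro n hn
    obtain ⟨a, b, h, rfl⟩ := hS n hn
    simp only [IsExtremalEdge, IsExtremalPair] at h
    interval_cases s <;> simp [Finset.range_add_one] <;> omega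
  exact (Finset.card_le_card hsum).trans (Finset.card_image_le.trans (Finset.card_range s).le)

theorem quadraticGrowth_le_card {m s : ℕ} (hs : s ≤ 5) (hm : s + 4 ≤ m) (S : Finset ℕ)
    (hS : ∀ a b c, IsExtremalEdge m s b c → IsExtremalEdge m s a c → IsExtremalEdge m s a b →
      a + b + c ∈ S) : quadraticGrowth s ≤ S.card := by
  have hmem : ∀ n a b c, IsExtremalEdge m s b c → IsExtremalEdge m s a c →
      IsExtremalEdge m s a b → a + b + c = n → n ∈ S := by
    rintro _ a b c hbc hac hab rfl
    exact hS a b c hbc hac hab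
  have e1 : 1 ≤ s → IsExtremalEdge m s (3 * m + 2) (3 * m + 2) := fun h =>
    Or.inl (Or.inl ⟨h, rfl, rfl⟩)
  have e2 : 2 ≤ s → IsExtremalEdge m s (3 * m + 2) (3 * m + 3) := fun h =>
    Or.inl (Or.inr (Or.inl ⟨h, rfl, rfl⟩))
  have e3 : 3 ≤ s → IsExtremalEdge m s (3 * m + 3) (3 * m + 3) := fun h =>
    Or.inl (Or.inr (Or.inr (Or.inl ⟨h, rfl, rfl⟩)))
  have e4 : s = 4 → IsExtremalEdge m s (3 * m + 2) (4 * m - 1) := fun h =>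
    Or.inl (Or.inr (Or.inr (Or.inr (Or.inl ⟨h, rfl, by omega⟩))))
  have e5 : s = 5 → IsExtremalEdge m s (3 * m + 2) (3 * m - 1) := fun h =>
    Or.inl (Or.inr (Or.inr (Or.inr (Or.inr (Or.inl ⟨h, rfl, by omega⟩)))))
  have e6 : s = 5 → IsExtremalEdge m s (3 * m - 1) (3 * m - 1) := fun h =>
    Or.inl (Or.inr (Or.inr (Or.inr (Or.inr (Or.inr ⟨h, by omega, by omega⟩)))))
  have h1 : 1 ≤ s → 9 * m + 6 ∈ S := fun h =>
    hmem _ _ _ _ (e1 h) (e1 h) (e1 h) (by omega)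
  have h2 : 2 ≤ s → 9 * m + 7 ∈ S := fun h =>
    hmem _ _ _ _ (e2 h) (e2 h) (e1 (by omega)) (by omega)
  have h3 : 3 ≤ s → 9 * m + 8 ∈ S := fun h =>
    hmem _ _ _ _ (e3 h) (e2 (by omega)) (e2 (by omega)) (by omega)
  have h4 : 3 ≤ s → 9 * m + 9 ∈ S := fun h =>
    hmem _ _ _ _ (e3 h) (e3 h) (e3 h) (by omega)
  have h5 : s = 4 → 10 * m + 3 ∈ S := fun h =>
    hmem _ _ _ _ (e4 h) (e4 h) (e1 (by omega)) (by omega)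
  have h6 : s = 5 → 9 * m + 3 ∈ S := fun h =>
    hmem _ _ _ _ (e5 h) (e5 h) (e1 (by omega)) (by omega)
  have h7 : s = 5 → 9 * m ∈ S := fun h =>
    hmem _ _ _ _ (e6 h) (e5 h) (e5 h) (by omega)
  have h8 : s = 5 → 9 * m - 3 ∈ S := fun h =>
    hmem _ _ _ _ (e6 h) (e6 h) (e6 h) (by omega)
  have key : ∀ l : List ℕ, l.Nodup → (∀ n ∈ l, n ∈ S) → l.length ≤ S.card := by
    intro l hl hlS
    rw [← List.toFinset_card_of_nodup hl]
    exact Finset.card_le_card fun n hn => hlS n (List.mem_toFinset.mp hn)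
  interval_cases s
  · exact Nat.zero_le _
  · exact key [9 * m + 6] (by simp) (by simp [h1])
  · exact key [9 * m + 6, 9 * m + 7] (by simp) (by simp [h1, h2])
  · exact key [9 * m + 6, 9 * m + 7, 9 * m + 8, 9 * m + 9] (by simp) (by simp [h1, h2, h3, h4])
  · exact key [9 * m + 6, 9 * m + 7, 9 * m + 8, 9 * m + 9, 10 * m + 3] (by simp; omega)
      (by simp [h1, h2, h3, h4, h5])
  · exact key [9 * m + 6, 9 * m + 7, 9 * m + 8, 9 * m + 9, 9 * m + 3, 9 * m, 9 * m - 3]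
      (by simp; omega) (by simp [h1, h2, h3, h4, h6, h7, h8])

theorem choose_two_add_quadraticGrowth_le {Γ : AddSubmonoid ℕ} [Fintype (minGens Γ)]
    (hΓ : Γ = extremalMonoid m s hs hm) {R : Set ((minGens Γ →₀ ℕ) × (minGens Γ →₀ ℕ))}
    (hR : R.Finite) (hgen : addConGen (fun a b => (a, b) ∈ R) = AddCon.ker (factorizationHom Γ)) :
    (Fintype.card (minGens Γ)).choose 2 + quadraticGrowth s ≤ R.ncard + s := by
  classical
  have hmemΓ : ∀ n, IsExtremalMem m s n → n ∈ Γ := by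
    rw [hΓ]
    exact fun _ => id
  have hmem {n : ℕ} : n ∈ minGens Γ ↔ n = m ∨ IsExtremalGen m s n :=
    hΓ ▸ mem_minGens_extremalMonoid hs hm
  let M : minGens Γ := ⟨m, hmem.mpr (Or.inl rfl)⟩
  have hne : ∀ g : minGens Γ, IsExtremalGen m s g → g ≠ M := by
    rintro g hg rfl
    simp only [IsExtremalGen, M] at hg
    omega
  have hedge : ∀ {a b}, IsExtremalEdge m s a b → IsExtremalGen m s a ∧ IsExtremalGen m s b :=
    fun h => h.elim (fun h => h.gen hs) (fun h => (h.gen hs).symm)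
  let D : Finset (minGens Γ →₀ ℕ) :=
    ((Finset.univ : Finset (minGens Γ × minGens Γ)).filter
      fun p => IsExtremalEdge m s p.1 p.2).image
      fun p => Finsupp.single p.1 1 + Finsupp.single p.2 1
  let T : Finset (minGens Γ →₀ ℕ) :=
    ((Finset.univ : Finset (minGens Γ × minGens Γ × minGens Γ)).filter
      fun p => IsExtremalEdge m s p.2.1 p.2.2 ∧ IsExtremalEdge m s p.1 p.2.2 ∧
        IsExtremalEdge m s p.1 p.2.1).image
      fun p => Finsupp.single p.1 1 + Finsupp.single p.2.1 1 + Finsupp.single p.2.2 1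
  have hmemD : ∀ u, u ∈ D ↔ ∃ a b : minGens Γ, IsExtremalEdge m s a b ∧
      Finsupp.single a 1 + Finsupp.single b 1 = u := by simp [D]
  have hmemT : ∀ u, u ∈ T ↔ ∃ a b c : minGens Γ, (IsExtremalEdge m s b c ∧
      IsExtremalEdge m s a c ∧ IsExtremalEdge m s a b) ∧
      Finsupp.single a 1 + Finsupp.single b 1 + Finsupp.single c 1 = u := by simp [T]
  have hD : ∀ d ∈ D, ∀ v, factorizationHom Γ v = factorizationHom Γ d → v = d := by
    intro d hd v hv
    obtain ⟨a, b, hab, rfl⟩ := (hmemD d).mp hd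
    subst hΓ
    refine hab.factorization_unique hs hm ?_
    simpa [factorizationHom_single] using hv
  have hle : ∀ n, IsExtremalGen m s n → m ≤ n := by
    intro n hn
    simp only [IsExtremalGen] at hn
    omega
  have hDcard : D.card ≤ s := by
    rw [← Finset.card_image_of_injOn (f := factorizationHom Γ)
      fun u _ v hv huv => hD v hv u huv]
    refine card_le_of_forall_isExtremalEdge (m := m) hs _ fun n hn => ?_
    obtain ⟨d, hd, rfl⟩ := Finset.mem_image.mp hn
    obtain ⟨a, b, hab, rfl⟩ := (hmemD d).mp hd
    exact ⟨a, b, hab, by simp [factorizationHom_single]⟩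
  have hTcard : quadraticGrowth s ≤ T.card := by
    refine (quadraticGrowth_le_card hs hm (T.image (factorizationHom Γ)) ?_).trans
      Finset.card_image_le
    intro a b c hbc hac hab
    refine Finset.mem_image.mpr ⟨_, (hmemT _).mpr ⟨⟨a, hmem.mpr (Or.inr (hedge hab).1)⟩,
      ⟨b, hmem.mpr (Or.inr (hedge hab).2)⟩, ⟨c, hmem.mpr (Or.inr (hedge hac).2)⟩,
      ⟨hbc, hac, hab⟩, rfl⟩, ?_⟩
    simp [factorizationHom_single]
  have := choose_two_add_card_le_ncard M D T ?_ hD ?_ ?_ hR hgen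
  · omega
  · intro u hu huD
    obtain ⟨h2, h0⟩ := mem_quadrics.mp hu
    obtain ⟨p, rfl⟩ := Finsupp.exists_ofSym2_of_degree_eq_two h2
    induction p using Sym2.ind with | _ a b
    rw [Finsupp.ofSym2_mk] at h0 huD ⊢
    have hgen : ∀ g : minGens Γ, g ≠ M → IsExtremalGen m s g := fun g hg =>
      (hmem.mp g.2).resolve_left fun h => hg (Subtype.ext h)
    have ha : IsExtremalGen m s a := hgen a (by rintro rfl; simp at h0)
    have hb : IsExtremalGen m s b := hgen b (by rintro rfl; simp at h0)
    have hab : ¬ IsExtremalEdge m s a b := fun h => huD ((hmemD _).mpr ⟨a, b, h, rfl⟩)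
    have hval : factorizationHom Γ (Finsupp.single a 1 + Finsupp.single b 1) = a + b := by
      simp [factorizationHom_single]
    rw [hval]
    have := hle a ha
    exact exists_factorization_apply_ne_zero M (show m ≤ _ by omega)
      (hmemΓ _ (ha.sub_mem hs hm hb (fun h => hab (Or.inl h)) fun h => hab (Or.inr h)))
  · intro t ht
    obtain ⟨a, b, c, ⟨hbc, hac, hab⟩, rfl⟩ := (hmemT t).mp ht
    refine ⟨a, b, c, hne _ (hedge hab).1, hne _ (hedge hab).2, hne _ (hedge hac).2, rfl, ?_⟩
    simp only [Finsupp.ofSym2_mk]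
    exact ⟨(hmemD _).mpr ⟨_, _, hbc, rfl⟩, (hmemD _).mpr ⟨_, _, hac, rfl⟩,
      (hmemD _).mpr ⟨_, _, hab, rfl⟩⟩
  · intro t ht
    obtain ⟨a, b, c, ⟨hbc, hac, hab⟩, rfl⟩ := (hmemT t).mp ht
    have hval : factorizationHom Γ
        (Finsupp.single a 1 + Finsupp.single b 1 + Finsupp.single c 1) = a + b + c := by
      simp [factorizationHom_single]
    rw [hval]
    have := hle a (hedge hab).1
    exact exists_factorization_apply_ne_zero M (show m ≤ _ by omega)
      (hmemΓ _ ((hedge hab).1.three_sub_mem hs hm (hedge hab).2 (hedge hac).2))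

end LowerBound

theorem exists_presentation_card_le_of_edim {Γ : AddSubmonoid ℕ} {s : ℕ} (hs : s ≤ 5)
    (h0 : edim Γ ≠ 0) (hms : mult Γ = edim Γ + s) :
    ∃ R : Set ((minGens Γ →₀ ℕ) × (minGens Γ →₀ ℕ)), R.Finite ∧
      R.ncard ≤ (edim Γ).choose 2 + quadraticGrowth s - s ∧
      addConGen (fun a b => (a, b) ∈ R) = AddCon.ker (factorizationHom Γ) := by
  have hfin : (minGens Γ).Finite := Set.finite_of_ncard_ne_zero h0
  have := hfin.fintype
  have hcard : Fintype.card (minGens Γ) = edim Γ := by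
    rw [edim, ← Nat.card_coe_set_eq, Nat.card_eq_fintype_card]
  rw [← hcard] at hms ⊢
  exact exists_presentation_card_le
    (m := ⟨mult Γ, mult_mem_minGens (by omega)⟩)
    (fun g => mult_le g.2.1 g.2.2.1) hs hms

theorem rho_le {Γ : AddSubmonoid ℕ} {s : ℕ} (hs : s ≤ 5) (h0 : edim Γ ≠ 0)
    (hms : mult Γ = edim Γ + s) : rho Γ ≤ (edim Γ).choose 2 + quadraticGrowth s - s := by
  obtain ⟨R, hR, hle, hgen⟩ := exists_presentation_card_le_of_edim hs h0 hms
  refine le_trans ?_ hle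
  rw [rho]
  exact Nat.sInf_le ⟨R, hR, rfl, hgen⟩

theorem le_rho_extremalMonoid {m s : ℕ} (hs : s ≤ 5) (hm : s + 4 ≤ m) :
    (m - s).choose 2 + quadraticGrowth s - s ≤ rho (extremalMonoid m s hs hm) := by
  have he := edim_extremalMonoid hs hm
  have hfin : (minGens (extremalMonoid m s hs hm)).Finite :=
    Set.finite_of_ncard_ne_zero (by rw [← edim]; omega)
  have := hfin.fintype
  obtain ⟨R, hR, -, hgen⟩ := exists_presentation_card_le_of_edim
    (Γ := extremalMonoid m s hs hm) hs (by omega) (by rw [he, mult_extremalMonoid]; omega)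
  rw [rho]
  refine le_csInf ⟨_, R, hR, rfl, hgen⟩ ?_
  rintro _ ⟨R, hR, rfl, hgen⟩
  have h := choose_two_add_quadraticGrowth_le hs hm rfl hR hgen
  rw [← Nat.card_eq_fintype_card, Nat.card_coe_set_eq, ← edim, he] at h
  omega

/-- If 3 ≤ e < m and m - e ≤ 6, then 𝒭(e,m) = 𝒞(e,m). -/
theorem rho_max_eq_C_of_small_diff (e m : ℕ) (he : 3 ≤ e) (hem : e < m) (hd : m - e ≤ 6) :
    (∀ Γ : AddSubmonoid ℕ, IsNumericalMonoid Γ →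
      edim Γ = e + 1 → mult Γ = m → rho Γ ≤ mathcalC e m) ∧
    (∃ Γ : AddSubmonoid ℕ, IsNumericalMonoid Γ ∧
      edim Γ = e + 1 ∧ mult Γ = m ∧ rho Γ = mathcalC e m) := by
  obtain ⟨s, rfl⟩ := Nat.exists_eq_add_of_le (Nat.succ_le_of_lt hem)
  have hs : s ≤ 5 := by omega
  have hm : s + 4 ≤ e + 1 + s := by omega
  rw [mathcalC_eq he rfl hs]
  have upper : ∀ Γ : AddSubmonoid ℕ, edim Γ = e + 1 → mult Γ = e + 1 + s →
      rho Γ ≤ (e + 1).choose 2 + quadraticGrowth s - s := by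
    intro Γ hΓ hmult
    have := rho_le hs (by omega) (hmult.trans (by rw [hΓ]))
    rwa [hΓ] at this
  have hedim : edim (extremalMonoid (e + 1 + s) s hs hm) = e + 1 := by
    rw [edim_extremalMonoid, Nat.add_sub_cancel]
  have hmult := mult_extremalMonoid hs hm
  refine ⟨fun Γ _ => upper Γ, extremalMonoid _ s hs hm, isNumericalMonoid_extremalMonoid hs hm,
    hedim, hmult, (upper _ hedim hmult).antisymm ?_⟩
  have := le_rho_extremalMonoid hs hm
  rwa [Nat.add_sub_cancel] at this
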